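/- (Theorem 3, h^{LMC_Ω} is a lower bound.) Let υ ∈ [0,1), let Ω be obtained from a sequence Ω' by inserting at most ⌊|Ω|·υ⌋ entries, each being an operator not occurring in the plan π, and let π be an s-plan for goal condition G complying with Ω'. Let C be an operator-counting constraint set for the goal-recognition task at s, and let LMC_Ω be the collection of landmark constraints for goal recognition: for each entry ω of Ω and each disjunctive action landmark L for state s and goal condition pre(ω), the constraint (Y^Ω_ω > 0 → Σ_{o∈L} Y_o ≥ 1). Then the assignment Y_o := occ_π(o) for all o ∈ O, Y^Ω_o := occ_Ω(o) if o occurs in π and 0 otherwise, satisfies C_Ω (with unreliability υ) and all constraints in LMC_Ω; consequently, the satisfying IP heuristic value with constraints C, C_Ω and LMC_Ω is at most cost(π), i.e., h^{LMC_Ω} is a lower bound on the cost of an optimal complying plan. -/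

import Mathlib

open scoped BigOperators ENNReal

/-- An operator `o` is applicable in state `s` iff its precondition is contained in `s`. -/
def Applicable {Op V D : Type} (preO : Op → V → Option D) (o : Op) (s : V → D) : Prop :=
  ∀ v d, preO o v = some d → s v = d

/-- The state resulting from applying operator `o` in state `s`. -/
def ApplyOp {Op V D : Type} (postO : Op → V → Option D) (o : Op) (s : V → D) : V → D :=
  fun v => (postO o v).getD (s v)

/-- A sequence of operators is sequentially applicable from a state. -/
def SeqApplicable {Op V D : Type} (preO postO : Op → V → Option D) :
    (V → D) → List Op → Prop
  | _, [] => True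
  | s, o :: rest => Applicable preO o s ∧ SeqApplicable preO postO (ApplyOp postO o s) rest

/-- The state reached after executing the sequence `π` from `s`. -/
def ExecList {Op V D : Type} (postO : Op → V → Option D) (s : V → D) (π : List Op) : V → D :=
  π.foldl (fun st o => ApplyOp postO o st) s

/-- A state satisfies a partial assignment (goal condition). -/
def SatisfiesGoal {V D : Type} (s : V → D) (G : V → Option D) : Prop :=
  ∀ v d, G v = some d → s v = d

/-- `π` is an `s`-plan for goal condition `G`. -/
def IsPlan {Op V D : Type} (preO postO : Op → V → Option D) (s : V → D)
    (π : List Op) (G : V → Option D) : Prop :=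
  SeqApplicable preO postO s π ∧ SatisfiesGoal (ExecList postO s π) G

/-- The cost of a plan: sum of the costs of its operators. -/
def PlanCost {Op : Type} (cost : Op → ℕ) (π : List Op) : ℕ := (π.map cost).sum

/-- The observation-counting constraints `C_Ω` with unreliability rating `υ`. -/
def ObsConstraints {Op : Type} [Fintype Op] [DecidableEq Op]
    (Ω : List Op) (υ : ℝ) (Y YΩ : Op → ℕ) : Prop :=
  (∀ o, YΩ o ≤ Ω.count o) ∧ (∀ o, YΩ o ≤ Y o) ∧
  (Ω.length - ⌊(Ω.length : ℝ) * υ⌋₊ ≤ ∑ o, YΩ o)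

/-- The satisfying IP heuristic value: infimum of the objective over all nonnegative
integer assignments that are feasible (`∞` if none exists). -/
noncomputable def IPValue {Op : Type} [Fintype Op] (cost : Op → ℕ)
    (Feas : (Op → ℕ) → Prop) : ℝ≥0∞ :=
  sInf {c : ℝ≥0∞ | ∃ Y : Op → ℕ, Feas Y ∧ c = ((∑ o, cost o * Y o : ℕ) : ℝ≥0∞)}

/-- `Ω` is obtained from `Ω'` by inserting, at arbitrary positions, entries that are
each an operator not occurring in `π`. -/
def NoisyFrom {Op : Type} [DecidableEq Op] (Ω Ω' π : List Op) : Prop :=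
  Ω'.Sublist Ω ∧ ∀ o, Ω'.count o < Ω.count o → o ∉ π

/-- An assignment (Y, Y^Ω) satisfies all landmark constraints for goal recognition
LMC_Ω: for each entry ω of Ω and each disjunctive action landmark L for state s and
goal condition pre(ω), if Y^Ω_ω > 0 then Σ_{o ∈ L} Y_o ≥ 1. -/
def LMCSat {Op V D : Type} (preO postO : Op → V → Option D) (s : V → D)
    (Ω : List Op) (Y YΩ : Op → ℕ) : Prop :=
  ∀ ω ∈ Ω, ∀ L : Finset Op,
    (∀ π' : List Op, IsPlan preO postO s π' (preO ω) → ∃ o ∈ L, o ∈ π') →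
    0 < YΩ ω → 1 ≤ ∑ o ∈ L, Y o

theorem sum_cost_count {Op : Type} [Fintype Op] [DecidableEq Op] (cost : Op → ℕ)
    (l : List Op) : ∑ o, cost o * l.count o = (l.map cost).sum := by
  induction l with
  | nil => simp
  | cons a l ih =>
    simp [List.count_cons, mul_add, Finset.sum_add_distrib, ih, add_comm]

theorem exists_prefix_plan {Op V D : Type} (preO postO : Op → V → Option D) (ω : Op)
    (π : List Op) : ∀ s : V → D, SeqApplicable preO postO s π → ω ∈ π →
      ∃ p : List Op, IsPlan preO postO s p (preO ω) ∧ ∀ o ∈ p, o ∈ π := by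
  induction π with
  | nil => intro s _ h; simp at h
  | cons a l ih =>
    intro s hs hm
    by_cases h : ω = a
    · subst h
      exact ⟨[], ⟨trivial, hs.1⟩, by simp⟩
    · have hm' : ω ∈ l := by simpa [h] using hm
      obtain ⟨p, hp, hsub⟩ := ih _ hs.2 hm'
      refine ⟨a :: p, ⟨⟨hs.1, hp.1⟩, hp.2⟩, ?_⟩
      intro o ho
      rcases List.mem_cons.1 ho with h1 | h1
      · simp [h1]
      · exact List.mem_cons_of_mem _ (hsub o h1)

/-- Theorem 3, h^{LMC_Ω} is a lower bound: under the noisy-observation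
hypotheses, the assignment Y_o := occ_π(o), Y^Ω_o := occ_Ω(o) if o occurs in π and 0
otherwise, satisfies C_Ω (with unreliability υ) and all landmark constraints LMC_Ω;
consequently, for every operator-counting constraint set C for the goal-recognition
task at s, the satisfying IP heuristic value with constraints C, C_Ω and LMC_Ω is at
most cost(π). -/
theorem lmc_heuristic_lower_bound {Op V D : Type} [Fintype Op] [DecidableEq Op]
    (preO postO : Op → V → Option D) (s : V → D) (G : V → Option D)
    (π Ω Ω' : List Op) (cost : Op → ℕ) (υ : ℝ)
    (hυ0 : 0 ≤ υ) (hυ1 : υ < 1)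
    (hnoisy : NoisyFrom Ω Ω' π)
    (hbound : Ω.length ≤ Ω'.length + ⌊(Ω.length : ℝ) * υ⌋₊)
    (hplan : IsPlan preO postO s π G) (hcomply : Ω'.Sublist π) :
    (ObsConstraints Ω υ (fun o => π.count o)
        (fun o => if o ∈ π then Ω.count o else 0) ∧
      LMCSat preO postO s Ω (fun o => π.count o)
        (fun o => if o ∈ π then Ω.count o else 0)) ∧
    ∀ C : (Op → ℕ) → Prop,
      (∀ π' : List Op, IsPlan preO postO s π' G → Ω'.Sublist π' →
        C (fun o => π'.count o)) →
      IPValue cost (fun Y => C Y ∧ ∃ YΩ : Op → ℕ,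
          ObsConstraints Ω υ Y YΩ ∧ LMCSat preO postO s Ω Y YΩ) ≤
        ((PlanCost cost π : ℕ) : ℝ≥0∞) := by
  have hcount : ∀ o ∈ π, Ω.count o = Ω'.count o := by
    intro o ho
    have h1 := hnoisy.1.count_le o
    have h2 : ¬ Ω'.count o < Ω.count o := fun h => hnoisy.2 o h ho
    omega
  have main : ObsConstraints Ω υ (fun o => π.count o)
        (fun o => if o ∈ π then Ω.count o else 0) ∧
      LMCSat preO postO s Ω (fun o => π.count o)
        (fun o => if o ∈ π then Ω.count o else 0) := by
    refine ⟨⟨?_, ?_, ?_⟩, ?_⟩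
    · intro o
      dsimp only
      split_ifs <;> simp
    · intro o
      dsimp only
      split_ifs with h
      · rw [hcount o h]
        exact hcomply.count_le o
      · simp
    · have h1 : ∑ o, (if o ∈ π then Ω.count o else 0) = Ω'.length := by
        have h2 := sum_cost_count (fun _ => 1) Ω'
        simp only [one_mul, List.map_const', List.sum_replicate, smul_eq_mul, mul_one] at h2
        rw [← h2]
        refine Finset.sum_congr rfl fun o _ => ?_
        split_ifs with h
        · exact hcount o h
        · exact (List.count_eq_zero_of_not_mem fun h' => h (hcomply.subset h')).symm
      rw [h1]
      omega
    · intro ω _ L hL hpos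
      have hω : ω ∈ π := by
        by_contra h
        simp [h] at hpos
      obtain ⟨p, hp, hsub⟩ := exists_prefix_plan preO postO ω π s hplan.1 hω
      obtain ⟨o, hoL, hop⟩ := hL p hp
      have h1 : 1 ≤ π.count o := List.count_pos_iff.2 (hsub o hop)
      exact h1.trans (Finset.single_le_sum (f := fun o => π.count o)
        (fun _ _ => Nat.zero_le _) hoL)
  refine ⟨main, fun C hC => sInf_le ?_⟩
  refine ⟨fun o => π.count o, ⟨hC π hplan hcomply, _, main⟩, ?_⟩
  rw [sum_cost_count]
  rfl
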